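/- For X ∈ {V, U} and integers r ≥ 1 and i ≥ 1, there is a bijection τ : X^r_{i,w̄c,right} → X^r_{i−1,w̄c,left} such that for every u ∈ X^r_{i,w̄c,right} the words u and τ(u) represent the same element of 𝒜_k (τ is obtained by interchanging the letter u_min with the adjacent substring of letters smaller than u_min − 1, and its inverse is the analogous map in the other direction). -/

import Mathlib

open scoped BigOperators Classical

noncomputable section

namespace MN

/-! ## Residues, words, canonical cyclic intervals -/

/-- The residues `ℤ/(k+1)ℤ`. -/
abbrev Idx (k : ℕ) := ZMod (k + 1)

/-- A word in the generators, recorded by its list of indices. -/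
abbrev Word (k : ℕ) := List (Idx k)

/-- The support of a word. -/
def supp (k : ℕ) (u : Word k) : Finset (Idx k) := u.toFinset

/-- The smallest `a ∈ {0,…,k}` (as a natural number) with `(a : ℤ/(k+1)) ∉ S`. -/
def gapNat (k : ℕ) (S : Finset (Idx k)) : ℕ :=
  if h : ∃ m : ℕ, m ≤ k ∧ (m : Idx k) ∉ S then Nat.find h else 0

/-- The gap element `a` of a proper subset `S`. -/
def gap (k : ℕ) (S : Finset (Idx k)) : Idx k := (gapNat k S : Idx k)

/-- Position of a residue `i` in the canonical cyclic interval
`I_S : a+1 < a+2 < ⋯ < k < 0 < ⋯ < a−1` (the gap `a` itself gets the junk position `k`). -/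
def pos (k : ℕ) (S : Finset (Idx k)) (i : Idx k) : ℕ := (i - gap k S - 1).val

/-- The list of positions of the letters of `u` in the canonical cyclic interval of its support. -/
def posList (k : ℕ) (u : Word k) : List ℕ := u.map (pos k (supp k u))

/-- A weak hook word of hook type V:
`i₁ > ⋯ > i_j < i_{j+1} < ⋯ < i_m` with respect to `I_{supp u}`. -/
def IsHookV (k : ℕ) (u : Word k) : Prop :=
  supp k u ≠ Finset.univ ∧
    ∃ (ds as : List ℕ) (v : ℕ),
      posList k u = ds ++ v :: as ∧
        List.Chain' (· > ·) (ds ++ [v]) ∧ List.Chain' (· < ·) (v :: as)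

/-- A weak hook word of hook type U:
`i₁ > ⋯ > i_j = i_{j+1} < ⋯ < i_m` with respect to `I_{supp u}`. -/
def IsHookU (k : ℕ) (u : Word k) : Prop :=
  supp k u ≠ Finset.univ ∧
    ∃ (ds as : List ℕ) (v : ℕ),
      posList k u = ds ++ v :: v :: as ∧
        List.Chain' (· > ·) (ds ++ [v]) ∧ List.Chain' (· < ·) (v :: as)

/-- A weak hook word. -/
def IsWeakHook (k : ℕ) (u : Word k) : Prop := IsHookV k u ∨ IsHookU k u

/-- The number of ascents `i_t < i_{t+1}` of a word. -/
def asc (k : ℕ) (u : Word k) : ℕ :=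
  ((posList k u).zip (posList k u).tail).countP fun p => decide (p.1 < p.2)

/-- The candidates `c` in the definition of `u_min`: letters `c` of `u` for which there is a
letter `a` of `u` with `a < c` in `I_{supp u}`, `a + 1 ≠ c`, and no letter `b` of `u` satisfies
`a < b < c`. -/
def uminCands (k : ℕ) (u : Word k) : Finset (Idx k) :=
  (supp k u).filter fun c =>
    ∃ a ∈ supp k u,
      pos k (supp k u) a < pos k (supp k u) c ∧ a + 1 ≠ c ∧
        ∀ b ∈ supp k u,
          ¬(pos k (supp k u) a < pos k (supp k u) b ∧
            pos k (supp k u) b < pos k (supp k u) c)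

/-- The letter `u_min` of `u` (junk value `0` if there is no candidate). -/
def umin (k : ℕ) (u : Word k) : Idx k :=
  if h : (uminCands k u).Nonempty then
    ((uminCands k u).exists_min_image (pos k (supp k u)) h).choose
  else 0

/-- The number of occurrences of `u_min` in `u` (`0` if there is no candidate). -/
def uminCount (k : ℕ) (u : Word k) : ℕ :=
  if (uminCands k u).Nonempty then u.count (umin k u) else 0

/-- A set of residues is `k`-connected if it is a proper subset of `{0,…,k}` which is an
interval with respect to its canonical cyclic interval order. -/
def IsKConnectedSet (k : ℕ) (S : Finset (Idx k)) : Prop :=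
  S ≠ Finset.univ ∧
    ∀ i ∈ S, ∀ j ∈ S, ∀ m : Idx k,
      pos k S i ≤ pos k S m → pos k S m ≤ pos k S j → m ∈ S

/-- A word is `k`-connected if its support is. -/
def IsKConnected (k : ℕ) (u : Word k) : Prop := IsKConnectedSet k (supp k u)

/-- A word is `k`-weak connected if `u_min` occurs `0` or `2` times in it. -/
def IsWeakConnected (k : ℕ) (u : Word k) : Prop :=
  uminCount k u = 0 ∨ uminCount k u = 2

/-- The letter `c` lies on the left side (the maximal strictly decreasing initial segment) of
the hook form of `u`: equivalently, it occurs in some strictly decreasing initial segment. -/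
def OnLeftSide (k : ℕ) (u : Word k) (c : Idx k) : Prop :=
  ∃ p q : Word k, u = p ++ q ∧
    List.Chain' (fun a b => pos k (supp k u) b < pos k (supp k u) a) p ∧ c ∈ p

/-- The letter `c` lies on the right side (the maximal strictly increasing final segment) of
the hook form of `u`. -/
def OnRightSide (k : ℕ) (u : Word k) (c : Idx k) : Prop :=
  ∃ p q : Word k, u = p ++ q ∧
    List.Chain' (fun a b => pos k (supp k u) a < pos k (supp k u) b) q ∧ c ∈ q

/-! ## The sets `X^r_i` and their refinements (indexed by `i : ℤ`, empty for `i < 0`) -/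

/-- `V^r_i`: weak hook words of hook type V, weak length `r`, `asc = i`. -/
def VSet (k r : ℕ) (i : ℤ) : Set (Word k) :=
  {u | IsHookV k u ∧ u.length = r ∧ (asc k u : ℤ) = i}

/-- `U^r_i`. -/
def USet (k r : ℕ) (i : ℤ) : Set (Word k) :=
  {u | IsHookU k u ∧ u.length = r ∧ (asc k u : ℤ) = i}

/-- `V^r_{i,wc}`: the `k`-weak connected members of `V^r_i`. -/
def VSetWC (k r : ℕ) (i : ℤ) : Set (Word k) := {u ∈ VSet k r i | IsWeakConnected k u}

/-- `U^r_{i,wc}`. -/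
def USetWC (k r : ℕ) (i : ℤ) : Set (Word k) := {u ∈ USet k r i | IsWeakConnected k u}

/-- `V^r_{i,c}`: the `k`-connected members of `V^r_i`. -/
def VSetC (k r : ℕ) (i : ℤ) : Set (Word k) := {u ∈ VSet k r i | IsKConnected k u}

/-- `V^r_{i,w̄c,left}`. -/
def VSetNWCL (k r : ℕ) (i : ℤ) : Set (Word k) :=
  {u ∈ VSet k r i | ¬IsWeakConnected k u ∧ OnLeftSide k u (umin k u)}

/-- `V^r_{i,w̄c,right}`. -/
def VSetNWCR (k r : ℕ) (i : ℤ) : Set (Word k) :=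
  {u ∈ VSet k r i | ¬IsWeakConnected k u ∧ OnRightSide k u (umin k u)}

/-- `U^r_{i,w̄c,left}`. -/
def USetNWCL (k r : ℕ) (i : ℤ) : Set (Word k) :=
  {u ∈ USet k r i | ¬IsWeakConnected k u ∧ OnLeftSide k u (umin k u)}

/-- `U^r_{i,w̄c,right}`. -/
def USetNWCR (k r : ℕ) (i : ℤ) : Set (Word k) :=
  {u ∈ USet k r i | ¬IsWeakConnected k u ∧ OnRightSide k u (umin k u)}

/-! ## The algebras `𝒜_k`, `ℋ_k`, `𝒩_k` -/

/-- The defining relations of `𝒜_k`. -/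
inductive AkRel (k : ℕ) : FreeAlgebra ℤ (Idx k) → FreeAlgebra ℤ (Idx k) → Prop
  | braid (i : Idx k) :
      AkRel k (FreeAlgebra.ι ℤ i * FreeAlgebra.ι ℤ (i + 1) * FreeAlgebra.ι ℤ i)
        (FreeAlgebra.ι ℤ (i + 1) * FreeAlgebra.ι ℤ i * FreeAlgebra.ι ℤ (i + 1))
  | comm (i j : Idx k) (h1 : i - j ≠ 1) (h2 : j - i ≠ 1) :
      AkRel k (FreeAlgebra.ι ℤ i * FreeAlgebra.ι ℤ j)
        (FreeAlgebra.ι ℤ j * FreeAlgebra.ι ℤ i)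

/-- The algebra `𝒜_k`. -/
abbrev Ak (k : ℕ) := RingQuot (AkRel k)

/-- The generator `A_i` of `𝒜_k`. -/
def Agen (k : ℕ) (i : Idx k) : Ak k := RingQuot.mkAlgHom ℤ (AkRel k) (FreeAlgebra.ι ℤ i)

/-- The element `A_{i₁} ⋯ A_{i_m}` of `𝒜_k` associated to a word. -/
def Aword (k : ℕ) (u : Word k) : Ak k := (u.map (Agen k)).prod

/-- The defining relations of the 0-Hecke algebra `ℋ_k`. -/
inductive HkRel (k : ℕ) : FreeAlgebra ℤ (Idx k) → FreeAlgebra ℤ (Idx k) → Prop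
  | braid (i : Idx k) :
      HkRel k (FreeAlgebra.ι ℤ i * FreeAlgebra.ι ℤ (i + 1) * FreeAlgebra.ι ℤ i)
        (FreeAlgebra.ι ℤ (i + 1) * FreeAlgebra.ι ℤ i * FreeAlgebra.ι ℤ (i + 1))
  | comm (i j : Idx k) (h1 : i - j ≠ 1) (h2 : j - i ≠ 1) :
      HkRel k (FreeAlgebra.ι ℤ i * FreeAlgebra.ι ℤ j)
        (FreeAlgebra.ι ℤ j * FreeAlgebra.ι ℤ i)
  | sq (i : Idx k) :
      HkRel k (FreeAlgebra.ι ℤ i * FreeAlgebra.ι ℤ i) (-(FreeAlgebra.ι ℤ i))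

/-- The 0-Hecke algebra `ℋ_k`. -/
abbrev Hk (k : ℕ) := RingQuot (HkRel k)

/-- The generator `H_i`. -/
def Hgen (k : ℕ) (i : Idx k) : Hk k := RingQuot.mkAlgHom ℤ (HkRel k) (FreeAlgebra.ι ℤ i)

/-- The element `H_{i₁} ⋯ H_{i_m}`. -/
def Hword (k : ℕ) (u : Word k) : Hk k := (u.map (Hgen k)).prod

/-- The defining relations of the nilCoxeter algebra `𝒩_k`. -/
inductive NkRel (k : ℕ) : FreeAlgebra ℤ (Idx k) → FreeAlgebra ℤ (Idx k) → Prop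
  | braid (i : Idx k) :
      NkRel k (FreeAlgebra.ι ℤ i * FreeAlgebra.ι ℤ (i + 1) * FreeAlgebra.ι ℤ i)
        (FreeAlgebra.ι ℤ (i + 1) * FreeAlgebra.ι ℤ i * FreeAlgebra.ι ℤ (i + 1))
  | comm (i j : Idx k) (h1 : i - j ≠ 1) (h2 : j - i ≠ 1) :
      NkRel k (FreeAlgebra.ι ℤ i * FreeAlgebra.ι ℤ j)
        (FreeAlgebra.ι ℤ j * FreeAlgebra.ι ℤ i)
  | sq (i : Idx k) :
      NkRel k (FreeAlgebra.ι ℤ i * FreeAlgebra.ι ℤ i) 0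

/-- The nilCoxeter algebra `𝒩_k`. -/
abbrev Nk (k : ℕ) := RingQuot (NkRel k)

/-- The generator `N_i`. -/
def Ngen (k : ℕ) (i : Idx k) : Nk k := RingQuot.mkAlgHom ℤ (NkRel k) (FreeAlgebra.ι ℤ i)

/-- The element `N_{i₁} ⋯ N_{i_m}`. -/
def Nword (k : ℕ) (u : Word k) : Nk k := (u.map (Ngen k)).prod

/-! ## The affine symmetric group -/

/-- The relators of the affine symmetric group `S̃_{k+1}`. -/
def CoxRels (k : ℕ) : Set (FreeGroup (Idx k)) :=
  {g | (∃ i : Idx k, g = FreeGroup.of i * FreeGroup.of i) ∨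
    (∃ i : Idx k,
      g = FreeGroup.of i * FreeGroup.of (i + 1) * FreeGroup.of i *
        (FreeGroup.of (i + 1) * FreeGroup.of i * FreeGroup.of (i + 1))⁻¹) ∨
    (∃ i j : Idx k, i - j ≠ 1 ∧ j - i ≠ 1 ∧
      g = FreeGroup.of i * FreeGroup.of j * (FreeGroup.of j * FreeGroup.of i)⁻¹)}

/-- The affine symmetric group `S̃_{k+1}`. -/
abbrev AffS (k : ℕ) := PresentedGroup (CoxRels k)

/-- The generator `s_i`. -/
def sgen (k : ℕ) (i : Idx k) : AffS k := PresentedGroup.of i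

/-- The product `s_{i₁} ⋯ s_{i_m}`. -/
def sword (k : ℕ) (u : Word k) : AffS k := (u.map (sgen k)).prod

/-- The Coxeter length of `w ∈ S̃_{k+1}`. -/
def len (k : ℕ) (w : AffS k) : ℕ :=
  sInf {m | ∃ u : Word k, u.length = m ∧ sword k u = w}

/-- `u` is a reduced word. -/
def IsReducedWord (k : ℕ) (u : Word k) : Prop := len k (sword k u) = u.length

/-- The finite symmetric group `S_{k+1} = ⟨s_1, …, s_k⟩` inside `S̃_{k+1}`. -/
def FinSub (k : ℕ) : Subgroup (AffS k) :=
  Subgroup.closure {g | ∃ i : Idx k, i ≠ 0 ∧ g = sgen k i}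

/-- `w` is a minimal-length coset representative of `S̃_{k+1}/S_{k+1}` (a Grassmannian
element). -/
def IsGrassmannian (k : ℕ) (w : AffS k) : Prop :=
  ∀ v : AffS k, w⁻¹ * v ∈ FinSub k → len k w ≤ len k v

/-! ## Anti-weak hook words -/

/-- Anti-weak hook word, first form: `i₁ < ⋯ < i_j > i_{j+1} > ⋯ > i_m`. -/
def IsAntiHookV (k : ℕ) (u : Word k) : Prop :=
  supp k u ≠ Finset.univ ∧
    ∃ (ds as : List ℕ) (v : ℕ),
      posList k u = ds ++ v :: as ∧
        List.Chain' (· < ·) (ds ++ [v]) ∧ List.Chain' (· > ·) (v :: as)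

/-- Anti-weak hook word, second form: `i₁ < ⋯ < i_j = i_{j+1} > ⋯ > i_m`. -/
def IsAntiHookU (k : ℕ) (u : Word k) : Prop :=
  supp k u ≠ Finset.univ ∧
    ∃ (ds as : List ℕ) (v : ℕ),
      posList k u = ds ++ v :: v :: as ∧
        List.Chain' (· < ·) (ds ++ [v]) ∧ List.Chain' (· > ·) (v :: as)

/-- Anti-weak hook word. -/
def IsAntiWeakHook (k : ℕ) (u : Word k) : Prop := IsAntiHookV k u ∨ IsAntiHookU k u

/-- Length of the maximal strictly increasing (w.r.t. `I_{supp u}`) initial segment of `u`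
(= the left side of an anti-weak hook word). -/
def incPrefixLen (k : ℕ) (u : Word k) : ℕ :=
  sSup {n | n ≤ u.length ∧
    List.Chain' (fun a b => pos k (supp k u) a < pos k (supp k u) b) (u.take n)}

/-- Length of the maximal strictly increasing (w.r.t. `I_{supp u}`) final segment of `u`
(= the right side of a weak hook word). -/
def incSuffixLen (k : ℕ) (u : Word k) : ℕ :=
  sSup {n | n ≤ u.length ∧
    List.Chain' (fun a b => pos k (supp k u) a < pos k (supp k u) b)
      (u.drop (u.length - n))}

/-! ## Noncommutative symmetric functions in `𝒜_k` -/

/-- The word underlying the cyclically decreasing element `d_A` (letters of `A` in decreasing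
position order, so that `A_{i+1}` occurs before `A_i` whenever `i, i+1 ∈ A`). -/
def dwordOf (k : ℕ) (A : Finset (Idx k)) : Word k :=
  (((A.image (pos k A)).sort (· ≤ ·)).reverse).map fun n => gap k A + 1 + (n : Idx k)

/-- The word underlying the cyclically increasing element `i_A`. -/
def iwordOf (k : ℕ) (A : Finset (Idx k)) : Word k :=
  ((A.image (pos k A)).sort (· ≤ ·)).map fun n => gap k A + 1 + (n : Idx k)

/-- The noncommutative homogeneous symmetric function `h_r = Σ_{|A| = r} d_A`. -/
def hFun (k r : ℕ) : Ak k :=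
  ∑ A ∈ Finset.powersetCard r (Finset.univ : Finset (Idx k)), Aword k (dwordOf k A)

/-- The noncommutative elementary symmetric function `e_r = Σ_{|A| = r} i_A`. -/
def eFun (k r : ℕ) : Ak k :=
  ∑ A ∈ Finset.powersetCard r (Finset.univ : Finset (Idx k)), Aword k (iwordOf k A)

/-- The noncommutative hook Schur function `s_{(r−i,1^i)}`. -/
def sHookFun (k r i : ℕ) : Ak k :=
  ∑ j ∈ Finset.range (i + 1), ((-1 : ℤ) ^ j) • (hFun k (r - i + j) * eFun k (i - j))

/-- The noncommutative power sum `p_r`. -/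
def pFun (k r : ℕ) : Ak k :=
  ∑ i ∈ Finset.range r, ((-1 : ℤ) ^ i) • sHookFun k r i

/-! ## Actions on the affine symmetric group -/

/-- The star action of a generator: `A_i * w = s_i w` if `l(s_i w) > l(w)`, else `w`. -/
def starG (k : ℕ) (i : Idx k) (w : AffS k) : AffS k :=
  if len k w < len k (sgen k i * w) then sgen k i * w else w

/-- The star action of a word: `A_{i₁}⋯A_{i_m} * w = A_{i₁} * (⋯ * (A_{i_m} * w))`. -/
def starW (k : ℕ) (u : Word k) (w : AffS k) : AffS k := u.foldr (starG k) w

/-- The dot action of a generator, with values in `S̃_{k+1} ∪ {0}`. -/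
def dotG (k : ℕ) (i : Idx k) : Option (AffS k) → Option (AffS k)
  | none => none
  | some w => if len k w < len k (sgen k i * w) then some (sgen k i * w) else none

/-- The dot action of a word. -/
def dotW (k : ℕ) (u : Word k) (o : Option (AffS k)) : Option (AffS k) :=
  u.foldr (dotG k) o

/-- Extension of an action datum `act : generator → S̃ → S̃ ∪ {0}` to `S̃ ∪ {0}`. -/
def actExt (k : ℕ) (act : Idx k → AffS k → Option (AffS k)) (i : Idx k) :
    Option (AffS k) → Option (AffS k)
  | none => none
  | some w => act i w

/-- Extension of an action datum to words. -/
def actW (k : ℕ) (act : Idx k → AffS k → Option (AffS k)) (u : Word k)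
    (o : Option (AffS k)) : Option (AffS k) :=
  u.foldr (actExt k act) o

/-! ## Rings and coefficients -/

/-- `(−1)^n` for an integer exponent `n`, in any ring. -/
def msign (R : Type*) [Ring R] (n : ℤ) : R := (((-1 : Rˣ) ^ n : Rˣ) : R)

/-- The power sum `p^R_r = Σ_{i=0}^{r−1} Σ_{j=0}^{i} (−1)^{i+j} h^R_{r−i+j} e^R_{i−j}` built from
Pieri data in a commutative ring. -/
def pR {R : Type*} [CommRing R] (h e : ℕ → R) (r : ℕ) : R :=
  ∑ i ∈ Finset.range r, ∑ j ∈ Finset.range (i + 1),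
    ((-1 : ℤ) ^ (i + j)) • (h (r - i + j) * e (i - j))

/-- The integer coefficient
`Σ_{i=0}^{r−1} (−1)^i |V^r_{i,wc} ∩ P| + Σ_{i=1}^{r−1} (−1)^i (r−i) |U^r_{i−1,wc} ∩ P|
 + Σ_{i=1}^{r−2} (−1)^i |U^r_{i−1,w̄c,left} ∩ P|`. -/
def MNcoeff (k r : ℕ) (P : Word k → Prop) : ℤ :=
  (∑ i ∈ Finset.range r, (-1 : ℤ) ^ i * ({u ∈ VSetWC k r (i : ℤ) | P u}.ncard : ℤ)) +
    (∑ i ∈ Finset.Icc 1 (r - 1),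
      (-1 : ℤ) ^ i * ((r : ℤ) - i) * ({u ∈ USetWC k r ((i : ℤ) - 1) | P u}.ncard : ℤ)) +
    ∑ i ∈ Finset.Icc 1 (r - 2),
      (-1 : ℤ) ^ i * ({u ∈ USetNWCL k r ((i : ℤ) - 1) | P u}.ncard : ℤ)

/-- The integer coefficient `Σ_{i=0}^{r−1} (−1)^i |V^r_{i,c} ∩ P|`. -/
def kcoeff (k r : ℕ) (P : Word k → Prop) : ℤ :=
  ∑ i ∈ Finset.range r, (-1 : ℤ) ^ i * ({u ∈ VSetC k r (i : ℤ) | P u}.ncard : ℤ)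

/-! ## Partitions, cores, bounded partitions -/

/-- A cell of a Young diagram: (row, column), `0`-indexed. -/
abbrev Cell := ℕ × ℕ

/-- A (finite) Young diagram, as a finite lower set of cells. -/
def IsYoung (S : Set Cell) : Prop :=
  S.Finite ∧ ∀ p ∈ S, ∀ q : Cell, q.1 ≤ p.1 → q.2 ≤ p.2 → q ∈ S

/-- The `(k+1)`-residue of a cell `(i,j)`, i.e. `j − i mod (k+1)`. -/
def res (k : ℕ) (c : Cell) : Idx k := (c.2 : Idx k) - (c.1 : Idx k)

/-- The hook length of a cell: arm + leg + 1. -/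
def hookLen (S : Set Cell) (c : Cell) : ℕ :=
  {j | c.2 < j ∧ (c.1, j) ∈ S}.ncard + {i | c.1 < i ∧ (i, c.2) ∈ S}.ncard + 1

/-- A `(k+1)`-core: a partition with no cell of hook length `k+1`. -/
def IsCore (k : ℕ) (S : Set Cell) : Prop :=
  IsYoung S ∧ ∀ c ∈ S, hookLen S c ≠ k + 1

/-- A `k`-bounded partition: every part is at most `k`. -/
def IsBounded (k : ℕ) (S : Set Cell) : Prop :=
  IsYoung S ∧ ∀ c ∈ S, c.2 < k

/-- A removable corner of `S`. -/
def Removable (S : Set Cell) (c : Cell) : Prop :=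
  c ∈ S ∧ (c.1 + 1, c.2) ∉ S ∧ (c.1, c.2 + 1) ∉ S

/-- An addable corner of `S`: a cell not in `S` whose addition yields a partition. -/
def Addable (S : Set Cell) (c : Cell) : Prop :=
  c ∉ S ∧ IsYoung (S ∪ {c})

/-- The map `𝔭` from `(k+1)`-cores to `k`-bounded partitions: row `i` of `𝔭(κ)` has as many
cells as there are cells of hook length at most `k` in row `i` of `κ`. -/
def pMap (k : ℕ) (S : Set Cell) : Set Cell :=
  {c | c.2 < {j | (c.1, j) ∈ S ∧ hookLen S (c.1, j) ≤ k}.ncard}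

/-- The inverse bijection `𝔭^{-1}` from `k`-bounded partitions to `(k+1)`-cores. -/
def pInv (k : ℕ) (lam : Set Cell) : Set Cell :=
  Function.invFunOn (pMap k) {S | IsCore k S} lam

/-- The transpose (conjugate) of a diagram. -/
def transposeSet (S : Set Cell) : Set Cell := {c | (c.2, c.1) ∈ S}

/-- The `k`-conjugate `λ^{(k)} = 𝔭((𝔭^{-1} λ)^t)`. -/
def kconj (k : ℕ) (lam : Set Cell) : Set Cell := pMap k (transposeSet (pInv k lam))

/-- A skew shape is a ribbon if it contains no `2×2` square. -/
def IsRibbon (D : Set Cell) : Prop :=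
  ∀ c : Cell, ¬((c.1, c.2) ∈ D ∧ (c.1 + 1, c.2) ∈ D ∧
    (c.1, c.2 + 1) ∈ D ∧ (c.1 + 1, c.2 + 1) ∈ D)

/-- A vertical strip: no two cells in the same row. -/
def IsVStrip (D : Set Cell) : Prop :=
  ∀ c ∈ D, ∀ c' ∈ D, c.1 = c'.1 → c = c'

/-- A horizontal strip: no two cells in the same column. -/
def IsHStrip (D : Set Cell) : Prop :=
  ∀ c ∈ D, ∀ c' ∈ D, c.2 = c'.2 → c = c'

/-- The height of a skew shape: the number of occupied rows minus the number of connected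
components; each connected component is counted by its unique last occupied row, i.e. an
occupied row sharing no column with the next row. -/
def htSkew (D : Set Cell) : ℕ :=
  {i : ℕ | ∃ j, (i, j) ∈ D}.ncard -
    {i : ℕ | (∃ j, (i, j) ∈ D) ∧ ¬∃ j, (i, j) ∈ D ∧ (i + 1, j) ∈ D}.ncard

/-- The set of `(k+1)`-residues of the cells of a skew shape. -/
def residSupp (k : ℕ) (D : Set Cell) : Finset (Idx k) :=
  Set.Finite.toFinset (Set.toFinite (res k '' D))

/-! ## Star and dot actions on cores and on `k`-bounded partitions -/

/-- The star action of `A_i` on `(k+1)`-cores together with `0`. -/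
def starC (k : ℕ) (i : Idx k) : Option (Set Cell) → Option (Set Cell)
  | none => none
  | some S =>
    if ∃ c, Addable S c ∧ res k c = i then some (S ∪ {c | Addable S c ∧ res k c = i})
    else if ∃ c, Removable S c ∧ res k c = i then some S
    else none

/-- The star action of a word on cores. -/
def starCW (k : ℕ) (u : Word k) (o : Option (Set Cell)) : Option (Set Cell) :=
  u.foldr (starC k) o

/-- The star action of a word on `k`-bounded partitions, transported through `𝔭`. -/
def starB (k : ℕ) (u : Word k) (lam : Set Cell) : Option (Set Cell) :=
  (starCW k u (some (pInv k lam))).map (pMap k)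

/-- The dot action of `A_i` on `(k+1)`-cores together with `0`. -/
def dotC (k : ℕ) (i : Idx k) : Option (Set Cell) → Option (Set Cell)
  | none => none
  | some S =>
    if ∃ c, Addable S c ∧ res k c = i then some (S ∪ {c | Addable S c ∧ res k c = i})
    else none

/-- The dot action of a word on cores. -/
def dotCW (k : ℕ) (u : Word k) (o : Option (Set Cell)) : Option (Set Cell) :=
  u.foldr (dotC k) o

/-- The dot action of a word on `k`-bounded partitions, transported through `𝔭`. -/
def dotB (k : ℕ) (u : Word k) (lam : Set Cell) : Option (Set Cell) :=
  (dotCW k u (some (pInv k lam))).map (pMap k)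

/-- The number of maximal segments of consecutive letters (w.r.t. the positions for `S`) of a
word `V`. -/
def numSegments (k : ℕ) (S : Finset (Idx k)) (V : Word k) : ℕ :=
  if V.length = 0 then 0
  else ((V.zip V.tail).countP fun p => decide (pos k S p.2 ≠ pos k S p.1 + 1)) + 1

/-- Conditions (K0)–(K4) of the Murnaghan–Nakayama rule for `K`-`k`-Schur functions. -/
def Kconds (k r : ℕ) (lam mu : Set Cell) : Prop :=
  lam ⊆ mu ∧ kconj k lam ⊆ kconj k mu ∧
    (mu \ lam).ncard ≤ r ∧
    IsRibbon (pInv k mu \ pInv k lam) ∧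
    (IsKConnectedSet k (residSupp k (pInv k mu \ pInv k lam)) ∨
      (residSupp k (pInv k mu \ pInv k lam)).card < r) ∧
    htSkew (mu \ lam) + htSkew (kconj k mu \ kconj k lam) < r

/-- Conditions (k0)–(k4) of the Murnaghan–Nakayama rule for `k`-Schur functions. -/
def kconds (k r : ℕ) (lam mu : Set Cell) : Prop :=
  lam ⊆ mu ∧ kconj k lam ⊆ kconj k mu ∧
    (mu \ lam).ncard = r ∧
    IsRibbon (pInv k mu \ pInv k lam) ∧
    IsKConnectedSet k (residSupp k (pInv k mu \ pInv k lam)) ∧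
    htSkew (mu \ lam) + htSkew (kconj k mu \ kconj k lam) = r - 1


def Hk0 (m : ℕ) (l : List ℕ) : Prop :=
  ∃ (ds as : List ℕ) (v : ℕ), l = ds ++ (List.replicate (m + 1) v ++ as) ∧
    ds.Pairwise (· > ·) ∧ as.Pairwise (· < ·) ∧ (∀ x ∈ ds, v < x) ∧ (∀ x ∈ as, v < x)

lemma Hk0.reverse {m : ℕ} {l : List ℕ} (h : Hk0 m l) : Hk0 m l.reverse := by
  obtain ⟨ds, as, v, rfl, h1, h2, h3, h4⟩ := h
  refine ⟨as.reverse, ds.reverse, v, by simp, ?_, ?_, ?_, ?_⟩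
  · rw [List.pairwise_reverse]; exact h2
  · rw [List.pairwise_reverse]; exact h1
  · simpa using h4
  · simpa using h3

lemma Hk0.append {m : ℕ} {L B R : List ℕ} (hB : Hk0 m B) (hL : L.Pairwise (· > ·))
    (hR : R.Pairwise (· < ·)) (hLB : ∀ x ∈ L, ∀ y ∈ B, y < x) (hBR : ∀ x ∈ R, ∀ y ∈ B, y < x) :
    Hk0 m (L ++ (B ++ R)) := by
  obtain ⟨ds, as, v, rfl, h1, h2, h3, h4⟩ := hB
  refine ⟨L ++ ds, as ++ R, v, by simp, ?_, ?_, ?_, ?_⟩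
  · rw [List.pairwise_append]
    exact ⟨hL, h1, fun a ha b hb => hLB a ha b (by simp [hb])⟩
  · rw [List.pairwise_append]
    exact ⟨h2, hR, fun a ha b hb => hBR b hb a (by simp [ha])⟩
  · intro x hx
    rcases List.mem_append.1 hx with hx | hx
    · exact hLB x hx v (by simp)
    · exact h3 x hx
  · intro x hx
    rcases List.mem_append.1 hx with hx | hx
    · exact h4 x hx
    · exact hBR x hx v (by simp)

lemma split_desc (c : ℕ) (ds : List ℕ) (h : ds.Pairwise (· > ·)) (hc : c ∉ ds) :
    ∃ L D, ds = L ++ D ∧ (∀ x ∈ L, c < x) ∧ (∀ x ∈ D, x < c) := by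
  induction ds with
  | nil => exact ⟨[], [], by simp⟩
  | cons a t ih =>
    rw [List.pairwise_cons] at h
    have hca : c ≠ a := fun e => hc (by simp [e])
    by_cases hac : a < c
    · refine ⟨[], a :: t, by simp, by simp, ?_⟩
      intro x hx
      rcases List.mem_cons.1 hx with rfl | hx
      · exact hac
      · have := h.1 x hx; omega
    · obtain ⟨L, D, rfl, h1, h2⟩ := ih h.2 (fun e => hc (by simp [e]))
      refine ⟨a :: L, D, by simp, ?_, h2⟩
      intro x hx
      rcases List.mem_cons.1 hx with rfl | hx
      · omega
      · exact h1 x hx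

structure Dec0 (m c : ℕ) (L B R : List ℕ) : Prop where
  hB : Hk0 m B
  hL : L.Pairwise (· > ·)
  hR : R.Pairwise (· < ·)
  cL : ∀ x ∈ L, c < x
  cR : ∀ x ∈ R, c < x
  cB : ∀ x ∈ B, x < c

lemma Hk0.ne_nil {m : ℕ} {l : List ℕ} (h : Hk0 m l) : l ≠ [] := by
  obtain ⟨ds, as, v, rfl, -⟩ := h
  simp [List.replicate_succ]

lemma Hk0.count {m c : ℕ} {l : List ℕ} (h : Hk0 m l) (hc0 : l.count c ≠ 0)
    (hc2 : l.count c ≠ 2) (ha : ∃ a ∈ l, a < c) : l.count c = 1 := by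
  obtain ⟨ds, as, v, rfl, h1, h2, h3, h4⟩ := h
  have hv : v ≠ c := by
    rintro rfl
    obtain ⟨a, ha, hlt⟩ := ha
    simp only [List.mem_append, List.mem_replicate] at ha
    rcases ha with ha | ha | ha
    · have := h3 a ha; omega
    · omega
    · have := h4 a ha; omega
  have e1 : ds.count c ≤ 1 := List.nodup_iff_count_le_one.1 (h1.imp (fun h => by omega)) c
  have e2 : as.count c ≤ 1 := List.nodup_iff_count_le_one.1 (h2.imp (fun h => by omega)) c
  have e3 : (List.replicate (m+1) v).count c = 0 := by
    rw [List.count_eq_zero]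
    intro h
    exact hv (List.eq_of_mem_replicate h).symm
  simp only [List.count_append, e3] at hc0 hc2 ⊢
  omega

lemma Hk0.right {m c : ℕ} {l : List ℕ} (h : Hk0 m l) (hc : l.count c = 1)
    (ha : ∃ a ∈ l, a < c)
    (hr : ∃ p q, l = p ++ q ∧ q.Pairwise (· < ·) ∧ c ∈ q) :
    ∃ L B R, l = L ++ (B ++ c :: R) ∧ Dec0 m c L B R := by
  obtain ⟨ds, as, v, rfl, h1, h2, h3, h4⟩ := h
  have hvc : v < c := by
    obtain ⟨a, ha, hlt⟩ := ha
    simp only [List.mem_append, List.mem_replicate] at ha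
    rcases ha with ha | ha | ha
    · have := h3 a ha; omega
    · omega
    · have := h4 a ha; omega
  have hcd : c ∉ ds := by
    intro hcd
    obtain ⟨d1, d2, rfl⟩ := List.append_of_mem hcd
    obtain ⟨p, q, e, hq, hcq⟩ := hr
    have hn : c ∉ d2 ++ (List.replicate (m+1) v ++ as) := by
      intro hmem
      have := List.count_pos_iff.2 hmem
      simp only [List.count_append, List.count_cons_self] at hc this
      omega
    rw [List.append_assoc, List.cons_append, List.append_eq_append_iff] at e
    have key : ∀ z, q = z ++ c :: (d2 ++ (List.replicate (m+1) v ++ as)) → False := by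
      rintro z rfl
      rw [List.pairwise_append, List.pairwise_cons] at hq
      have := hq.2.1.1 v (by simp)
      omega
    rcases e with ⟨a', e1, e2⟩ | ⟨a', e1, e2⟩
    · cases a' with
      | nil => exact key [] (by simpa using e2.symm)
      | cons b a' =>
        simp only [List.cons_append, List.cons.injEq] at e2
        apply hn
        rw [e2.2]
        simp [hcq]
    · exact key a' e2
  have hca : c ∈ as := by
    have : c ∈ ds ++ (List.replicate (m+1) v ++ as) := by
      rw [← List.count_pos_iff]; omega
    simp only [List.mem_append, List.mem_replicate] at this
    rcases this with h | h | h
    · exact absurd h hcd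
    · omega
    · exact h
  obtain ⟨a1, a2, rfl⟩ := List.append_of_mem hca
  obtain ⟨L, D, rfl, hL, hD⟩ := split_desc c ds h1 hcd
  rw [List.pairwise_append] at h1 h2
  obtain ⟨p1, p2, p3⟩ := h2
  rw [List.pairwise_cons] at p2
  refine ⟨L, D ++ (List.replicate (m+1) v ++ a1), a2, by simp, ?_, h1.1, p2.2, hL, p2.1, ?_⟩
  · exact ⟨D, a1, v, rfl, h1.2.1, p1, fun x hx => h3 x (by simp [hx]),
      fun x hx => h4 x (by simp [hx])⟩
  · intro x hx
    simp only [List.mem_append, List.mem_replicate] at hx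
    rcases hx with hx | hx | hx
    · exact hD x hx
    · omega
    · exact p3 x hx c (by simp)

lemma Dec0.reverse {m c : ℕ} {L B R : List ℕ} (h : Dec0 m c L B R) :
    Dec0 m c R.reverse B.reverse L.reverse where
  hB := h.hB.reverse
  hL := by rw [List.pairwise_reverse]; exact h.hR
  hR := by rw [List.pairwise_reverse]; exact h.hL
  cL := by simpa using h.cR
  cR := by simpa using h.cL
  cB := by simpa using h.cB

lemma Hk0.left {m c : ℕ} {l : List ℕ} (h : Hk0 m l) (hc : l.count c = 1)
    (ha : ∃ a ∈ l, a < c)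
    (hr : ∃ p q, l = p ++ q ∧ p.Pairwise (· > ·) ∧ c ∈ p) :
    ∃ L B R, l = L ++ c :: (B ++ R) ∧ Dec0 m c L B R := by
  obtain ⟨L, B, R, e, hd⟩ := h.reverse.right (c := c) (by simpa using hc) (by simpa using ha) (by
    obtain ⟨p, q, rfl, h1, h2⟩ := hr
    exact ⟨q.reverse, p.reverse, by simp, by rw [List.pairwise_reverse]; exact h1, by simpa using h2⟩)
  refine ⟨_, _, _, ?_, hd.reverse⟩
  rw [← List.reverse_reverse l, e]
  simp

lemma Dec0.hookR {m c : ℕ} {L B R : List ℕ} (h : Dec0 m c L B R) :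
    Hk0 m (L ++ (B ++ c :: R)) := by
  refine h.hB.append h.hL (List.pairwise_cons.2 ⟨h.cR, h.hR⟩) ?_ ?_
  · intro x hx y hy; exact (h.cB y hy).trans (h.cL x hx)
  · intro x hx y hy
    rcases List.mem_cons.1 hx with rfl | hx
    · exact h.cB y hy
    · exact (h.cB y hy).trans (h.cR x hx)

lemma Dec0.hookL {m c : ℕ} {L B R : List ℕ} (h : Dec0 m c L B R) :
    Hk0 m (L ++ c :: (B ++ R)) := by
  have := h.reverse.hookR.reverse
  simpa using this

def asc0 (l : List ℕ) : ℕ := (l.zip l.tail).countP fun p => decide (p.1 < p.2)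

lemma asc0_cons (a b : ℕ) (l : List ℕ) :
    asc0 (a :: b :: l) = asc0 (b :: l) + if a < b then 1 else 0 := by
  simp [asc0, List.countP_cons]

lemma asc0_gt (L M : List ℕ) (h : ∀ x ∈ L, ∀ y ∈ M.head?, y < x) :
    asc0 (L ++ M) = asc0 L + asc0 M := by
  induction L with
  | nil => simp [asc0]
  | cons a t ih =>
    have ih := ih (fun x hx => h x (by simp [hx]))
    cases t with
    | nil =>
      cases M with
      | nil => simp [asc0]
      | cons b M =>
        have := h a (by simp) b (by simp)
        simp only [List.cons_append, List.nil_append, asc0_cons]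
        simp [asc0]; omega
    | cons b t =>
      simp only [List.cons_append, asc0_cons] at ih ⊢
      omega

lemma asc0_lt (L M : List ℕ) (hL : L ≠ []) (hM : M ≠ []) (h : ∀ x ∈ L, ∀ y ∈ M, x < y) :
    asc0 (L ++ M) = asc0 L + 1 + asc0 M := by
  induction L with
  | nil => exact absurd rfl hL
  | cons a t ih =>
    cases t with
    | nil =>
      cases M with
      | nil => exact absurd rfl hM
      | cons b M =>
        have := h a (by simp) b (by simp)
        simp only [List.cons_append, List.nil_append, asc0_cons, this, if_true]
        simp [asc0]; omega
    | cons b t =>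
      have ih := ih (by simp) (fun x hx => h x (by simp [hx]))
      simp only [List.cons_append, asc0_cons] at ih ⊢
      omega

lemma Dec0.asc {m c : ℕ} {L B R : List ℕ} (h : Dec0 m c L B R) :
    asc0 (L ++ (B ++ c :: R)) = asc0 (L ++ c :: (B ++ R)) + 1 := by
  have hBn := h.hB.ne_nil
  have hcB := h.cB
  have hcL := h.cL
  have hcR := h.cR
  have hBR : ∀ x ∈ B, ∀ y ∈ R, x < y := fun x hx y hy => (h.cB x hx).trans (h.cR y hy)
  have e1 : asc0 (L ++ (B ++ c :: R)) = asc0 L + asc0 (B ++ c :: R) := by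
    apply asc0_gt
    intro x hx y hy
    have := h.cL x hx
    cases B with
    | nil => exact absurd rfl hBn
    | cons b B =>
      have := hcB b (by simp)
      simp at hy
      omega
  have e2 : asc0 (L ++ c :: (B ++ R)) = asc0 L + asc0 (c :: (B ++ R)) := by
    apply asc0_gt
    intro x hx y hy
    have := h.cL x hx
    simp at hy
    omega
  have e3 : asc0 (c :: (B ++ R)) = asc0 (B ++ R) := by
    cases B with
    | nil => exact absurd rfl hBn
    | cons b B =>
      have := hcB b (by simp)
      simp only [List.cons_append, asc0_cons]
      rw [if_neg (by omega)]; rfl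
  have e4 : asc0 (B ++ c :: R) = asc0 B + 1 + asc0 (c :: R) := by
    apply asc0_lt _ _ hBn (by simp)
    intro x hx y hy
    rcases List.mem_cons.1 hy with rfl | hy
    · exact hcB x hx
    · exact hBR x hx y hy
  rw [e1, e2, e3, e4]
  by_cases hR : R = []
  · subst hR
    simp [asc0]; omega
  · rw [asc0_lt B R hBn hR hBR]
    have := asc0_lt [c] R (by simp) hR (by simpa using hcR)
    simp only [List.cons_append, List.nil_append] at this
    have z : asc0 [c] = 0 := by simp [asc0]
    omega

lemma split_unique {α : Type*} (P : α → Prop) (L M L' M' : List α)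
    (hL : ∀ x ∈ L, P x) (hL' : ∀ x ∈ L', P x)
    (hM : ∀ x ∈ M.head?, ¬ P x) (hM' : ∀ x ∈ M'.head?, ¬ P x)
    (h : L ++ M = L' ++ M') : L = L' ∧ M = M' := by
  induction L generalizing L' with
  | nil =>
    cases L' with
    | nil => exact ⟨rfl, by simpa using h⟩
    | cons a t =>
      exfalso
      simp only [List.nil_append] at h
      subst h
      exact hM a (by simp) (hL' a (by simp))
  | cons a t ih =>
    cases L' with
    | nil =>
      exfalso
      simp only [List.nil_append] at h
      subst h
      exact hM' a (by simp) (hL a (by simp))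
    | cons b t' =>
      simp only [List.cons_append, List.cons.injEq] at h
      obtain ⟨e1, e2⟩ := ih t' (fun x hx => hL x (by simp [hx])) (fun x hx => hL' x (by simp [hx])) h.2
      exact ⟨by rw [h.1, e1], e2⟩

lemma gap_notMem (k : ℕ) (S : Finset (Idx k)) (hS : S ≠ Finset.univ) : gap k S ∉ S := by
  have h : ∃ m : ℕ, m ≤ k ∧ (m : Idx k) ∉ S := by
    by_contra hcon
    push Not at hcon
    apply hS
    ext x
    simp only [Finset.mem_univ, iff_true]
    have := hcon x.val (by have := ZMod.val_lt x; omega)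
    rwa [ZMod.natCast_zmod_val] at this
  unfold gap gapNat
  rw [dif_pos h]
  exact (Nat.find_spec h).2

lemma pos_inj (k : ℕ) (S : Finset (Idx k)) : Function.Injective (pos k S) := by
  intro a b h
  have := ZMod.val_injective (k+1) h
  simpa using this

lemma pos_le (k : ℕ) (S : Finset (Idx k)) (a : Idx k) : pos k S a ≤ k := by
  have := ZMod.val_lt (a - gap k S - 1)
  unfold pos
  omega

lemma pos_lt (k : ℕ) (S : Finset (Idx k)) (hS : S ≠ Finset.univ) (a : Idx k) (ha : a ∈ S) :
    pos k S a < k := by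
  refine lt_of_le_of_ne (pos_le k S a) ?_
  intro h
  have h1 : pos k S (gap k S) = k := by
    unfold pos
    rw [sub_self, zero_sub]
    exact ZMod.val_neg_one k
  have := pos_inj k S (h.trans h1.symm)
  exact gap_notMem k S hS (this ▸ ha)

lemma pos_succ (k : ℕ) (S : Finset (Idx k)) (a : Idx k) (ha : pos k S a < k) :
    pos k S (a + 1) = pos k S a + 1 := by
  unfold pos at *
  have e : a + 1 - gap k S - 1 = (a - gap k S - 1) + 1 := by ring
  rw [e, ZMod.val_add, ZMod.val_one_eq_one_mod, Nat.mod_eq_of_lt (a := 1) (by omega),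
    Nat.mod_eq_of_lt (by omega)]

def candsS (k : ℕ) (S : Finset (Idx k)) : Finset (Idx k) :=
  S.filter fun c =>
    ∃ a ∈ S, pos k S a < pos k S c ∧ a + 1 ≠ c ∧
        ∀ b ∈ S, ¬(pos k S a < pos k S b ∧ pos k S b < pos k S c)

def uminS (k : ℕ) (S : Finset (Idx k)) : Idx k :=
  if h : (candsS k S).Nonempty then
    ((candsS k S).exists_min_image (pos k S) h).choose
  else 0

lemma cands_eq (k : ℕ) (u : Word k) : uminCands k u = candsS k (supp k u) := rfl

lemma umin_eq (k : ℕ) (u : Word k) : umin k u = uminS k (supp k u) := rfl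

lemma uminS_mem (k : ℕ) (S : Finset (Idx k)) (h : (candsS k S).Nonempty) :
    uminS k S ∈ candsS k S := by
  unfold uminS
  rw [dif_pos h]
  exact ((candsS k S).exists_min_image (pos k S) h).choose_spec.1

lemma comm_of (k : ℕ) (S : Finset (Idx k)) (hS : S ≠ Finset.univ) (c b : Idx k)
    (hc : c ∈ candsS k S) (hb : b ∈ S) (hbc : pos k S b < pos k S c) :
    Commute (Agen k c) (Agen k b) := by
  obtain ⟨hcS, a, haS, hac, hne, hbet⟩ := Finset.mem_filter.1 hc
  have h1 : c - b ≠ 1 := by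
    intro h
    have hcb : c = b + 1 := by rw [← h]; ring
    have := pos_succ k S b (pos_lt k S hS b hb)
    rw [← hcb] at this
    have h2 := hbet b hb
    have : pos k S a = pos k S b := by omega
    have := pos_inj k S this
    exact hne (this ▸ hcb.symm)
  have h2 : b - c ≠ 1 := by
    intro h
    have hcb : b = c + 1 := by rw [← h]; ring
    have := pos_succ k S c (pos_lt k S hS c hcS)
    rw [← hcb] at this
    omega
  have := RingQuot.mkAlgHom_rel ℤ (AkRel.comm (k := k) c b h1 h2)
  rw [map_mul, map_mul] at this
  exact this

lemma Aword_swap (k : ℕ) (L B R : Word k) (c : Idx k)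
    (h : ∀ b ∈ B, Commute (Agen k c) (Agen k b)) :
    Aword k (L ++ (B ++ c :: R)) = Aword k (L ++ c :: (B ++ R)) := by
  have hB : Commute (Agen k c) (B.map (Agen k)).prod := by
    apply Commute.list_prod_right
    intro x hx
    obtain ⟨b, hb, rfl⟩ := List.mem_map.1 hx
    exact h b hb
  unfold Aword
  simp only [List.map_append, List.map_cons, List.prod_append, List.prod_cons]
  rw [← mul_assoc (Agen k c), hB.eq, mul_assoc]

def HookW (k m : ℕ) (u : Word k) : Prop := supp k u ≠ Finset.univ ∧ Hk0 m (posList k u)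

lemma hookV_iff (k : ℕ) (u : Word k) : IsHookV k u ↔ HookW k 0 u := by
  unfold IsHookV HookW Hk0
  simp only [List.Chain', List.isChain_iff_pairwise]
  refine and_congr_right fun _ => exists_congr fun ds => exists_congr fun as =>
    exists_congr fun v => ?_
  simp only [List.pairwise_append, List.pairwise_cons, zero_add, List.replicate_one,
    List.singleton_append]
  constructor
  · rintro ⟨a, ⟨b, -, c⟩, d, e⟩
    exact ⟨a, b, e, fun x hx => c x hx v (by simp), d⟩
  · rintro ⟨a, b, e, c, d⟩
    exact ⟨a, ⟨b, by simp, by simpa using c⟩, d, e⟩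

lemma hookU_iff (k : ℕ) (u : Word k) : IsHookU k u ↔ HookW k 1 u := by
  unfold IsHookU HookW Hk0
  simp only [List.Chain', List.isChain_iff_pairwise]
  refine and_congr_right fun _ => exists_congr fun ds => exists_congr fun as =>
    exists_congr fun v => ?_
  simp only [List.pairwise_append, List.pairwise_cons, List.replicate_succ, List.replicate_zero,
    List.cons_append, List.nil_append]
  constructor
  · rintro ⟨a, ⟨b, -, c⟩, d, e⟩
    exact ⟨a, b, e, fun x hx => c x hx v (by simp), d⟩
  · rintro ⟨a, b, e, c, d⟩
    exact ⟨a, ⟨b, by simp, by simpa using c⟩, d, e⟩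

def SR (k m r : ℕ) (i : ℤ) : Set (Word k) :=
  {u | (HookW k m u ∧ u.length = r ∧ (asc k u : ℤ) = i) ∧
    ¬IsWeakConnected k u ∧ OnRightSide k u (umin k u)}

def SL (k m r : ℕ) (i : ℤ) : Set (Word k) :=
  {u | (HookW k m u ∧ u.length = r ∧ (asc k u : ℤ) = i) ∧
    ¬IsWeakConnected k u ∧ OnLeftSide k u (umin k u)}

structure WD (k m : ℕ) (S : Finset (Idx k)) (c : Idx k) (L B R : Word k) : Prop where
  hS : S ≠ Finset.univ
  ne : (candsS k S).Nonempty
  hc : uminS k S = c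
  dec : Dec0 m (pos k S c) (L.map (pos k S)) (B.map (pos k S)) (R.map (pos k S))

lemma WD.count {k m : ℕ} {S : Finset (Idx k)} {c : Idx k} {L B R : Word k}
    (h : WD k m S c L B R) : L.count c = 0 ∧ B.count c = 0 ∧ R.count c = 0 := by
  obtain ⟨-, -, -, -, -, -, h1, h2, h3⟩ := h
  refine ⟨List.count_eq_zero.2 fun h => ?_, List.count_eq_zero.2 fun h => ?_,
    List.count_eq_zero.2 fun h => ?_⟩
  · exact lt_irrefl _ (h1 _ (List.mem_map_of_mem h))
  · exact lt_irrefl _ (h3 _ (List.mem_map_of_mem h))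
  · exact lt_irrefl _ (h2 _ (List.mem_map_of_mem h))

lemma WD.memR {k m : ℕ} {S : Finset (Idx k)} {c : Idx k} {L B R u : Word k}
    (h : WD k m S c L B R) (hu : u = L ++ (B ++ c :: R)) (hs : supp k u = S) (r : ℕ) (i : ℤ)
    (hr : u.length = r) (hi : (asc k u : ℤ) = i) : u ∈ SR k m r i := by
  refine ⟨⟨⟨hs ▸ h.hS, ?_⟩, hr, hi⟩, ?_, ?_⟩
  · have := h.dec.hookR
    unfold posList
    rw [hs, hu]
    simpa using this
  · unfold IsWeakConnected uminCount
    rw [cands_eq, umin_eq, hs, if_pos h.ne, h.hc, hu]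
    obtain ⟨h1, h2, h3⟩ := h.count
    simp [h1, h2, h3]
  · rw [umin_eq, hs, h.hc]
    refine ⟨L ++ B, c :: R, by simp [hu], ?_, by simp⟩
    rw [hs]
    have := h.dec
    have h2 : (List.map (pos k S) (c :: R)).Pairwise (· < ·) := by
      rw [List.map_cons, List.pairwise_cons]
      exact ⟨this.cR, this.hR⟩
    rw [List.pairwise_map] at h2
    exact h2.isChain

lemma WD.memL {k m : ℕ} {S : Finset (Idx k)} {c : Idx k} {L B R u : Word k}
    (h : WD k m S c L B R) (hu : u = L ++ c :: (B ++ R)) (hs : supp k u = S) (r : ℕ) (i : ℤ)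
    (hr : u.length = r) (hi : (asc k u : ℤ) = i) : u ∈ SL k m r i := by
  refine ⟨⟨⟨hs ▸ h.hS, ?_⟩, hr, hi⟩, ?_, ?_⟩
  · have := h.dec.hookL
    unfold posList
    rw [hs, hu]
    simpa using this
  · unfold IsWeakConnected uminCount
    rw [cands_eq, umin_eq, hs, if_pos h.ne, h.hc, hu]
    obtain ⟨h1, h2, h3⟩ := h.count
    simp [h1, h2, h3]
  · rw [umin_eq, hs, h.hc]
    refine ⟨L ++ [c], B ++ R, by simp [hu], ?_, by simp⟩
    rw [hs]
    have := h.dec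
    have h2 : (List.map (pos k S) (L ++ [c])).Pairwise (· > ·) := by
      rw [List.map_append, List.pairwise_append]
      exact ⟨this.hL, by simp, fun a ha b hb => by
        have := this.cL a ha
        simp at hb
        omega⟩
    rw [List.pairwise_map] at h2
    exact h2.isChain

lemma swap_perm {α : Type*} (L B R : List α) (c : α) :
    (L ++ (B ++ c :: R)).Perm (L ++ c :: (B ++ R)) :=
  List.Perm.append_left L List.perm_middle

lemma supp_swap (k : ℕ) (L B R : Word k) (c : Idx k) :
    supp k (L ++ (B ++ c :: R)) = supp k (L ++ c :: (B ++ R)) :=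
  List.toFinset_eq_of_perm _ _ (swap_perm L B R c)

lemma WD.asc {k m : ℕ} {S : Finset (Idx k)} {c : Idx k} {L B R u w : Word k}
    (h : WD k m S c L B R) (hu : u = L ++ (B ++ c :: R)) (hw : w = L ++ c :: (B ++ R))
    (hs : supp k u = S) (hs' : supp k w = S) : MN.asc k u = MN.asc k w + 1 := by
  have := h.dec.asc
  change asc0 (posList k u) = asc0 (posList k w) + 1
  unfold posList
  rw [hs, hs', hu, hw]
  simpa using this

lemma facts {k m : ℕ} {u : Word k} (h : HookW k m u) (hwc : ¬ IsWeakConnected k u) :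
    (candsS k (supp k u)).Nonempty ∧
    (posList k u).count (pos k (supp k u) (umin k u)) = 1 ∧
    ∃ a ∈ posList k u, a < pos k (supp k u) (umin k u) := by
  have hne : (uminCands k u).Nonempty := by
    by_contra hn
    exact hwc (Or.inl (by unfold uminCount; rw [if_neg hn]))
  have hm := uminS_mem k _ hne
  rw [← umin_eq] at hm
  obtain ⟨hcS, a, haS, hac, -⟩ := Finset.mem_filter.1 hm
  have ha : ∃ a ∈ posList k u, a < pos k (supp k u) (umin k u) :=
    ⟨_, List.mem_map_of_mem (List.mem_toFinset.1 haS), hac⟩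
  have hcount : (posList k u).count (pos k (supp k u) (umin k u)) = u.count (umin k u) :=
    List.count_map_of_injective _ _ (pos_inj k _) _
  unfold IsWeakConnected uminCount at hwc
  rw [if_pos hne] at hwc
  push Not at hwc
  exact ⟨hne, h.2.count (hcount ▸ hwc.1) (hcount ▸ hwc.2) ha, ha⟩

lemma exR {k m r : ℕ} {i : ℤ} {u : Word k} (hu : u ∈ SR k m r i) :
    ∃ L B R, u = L ++ (B ++ umin k u :: R) ∧ WD k m (supp k u) (umin k u) L B R := by
  obtain ⟨⟨hh, -, -⟩, hwc, p, q, hpq, hch, hcq⟩ := hu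
  obtain ⟨hne, hc, ha⟩ := facts hh hwc
  obtain ⟨L, B, R, e, hd⟩ := hh.2.right hc ha ⟨p.map (pos k (supp k u)), q.map (pos k (supp k u)),
    by rw [← List.map_append, ← hpq]; rfl, by
      rw [← List.isChain_iff_pairwise, List.isChain_map]; exact hch, List.mem_map_of_mem hcq⟩
  unfold posList at e
  obtain ⟨L, M, e1, rfl, e2⟩ := List.map_eq_append_iff.1 e
  obtain ⟨B, M, rfl, rfl, e4⟩ := List.map_eq_append_iff.1 e2
  obtain ⟨c, R, rfl, e3, rfl⟩ := List.map_eq_cons_iff.1 e4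
  have := pos_inj k _ e3
  subst this
  exact ⟨L, B, R, e1, hh.1, hne, rfl, hd⟩

lemma exL {k m r : ℕ} {i : ℤ} {u : Word k} (hu : u ∈ SL k m r i) :
    ∃ L B R, u = L ++ umin k u :: (B ++ R) ∧ WD k m (supp k u) (umin k u) L B R := by
  obtain ⟨⟨hh, -, -⟩, hwc, p, q, hpq, hch, hcq⟩ := hu
  obtain ⟨hne, hc, ha⟩ := facts hh hwc
  obtain ⟨L, B, R, e, hd⟩ := hh.2.left hc ha ⟨p.map (pos k (supp k u)), q.map (pos k (supp k u)),
    by rw [← List.map_append, ← hpq]; rfl, by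
      rw [← List.isChain_iff_pairwise, List.isChain_map]; exact hch, List.mem_map_of_mem hcq⟩
  unfold posList at e
  obtain ⟨L, M, e1, rfl, e2⟩ := List.map_eq_append_iff.1 e
  obtain ⟨c, M, rfl, e3, e4⟩ := List.map_eq_cons_iff.1 e2
  obtain ⟨B, R, rfl, rfl, rfl⟩ := List.map_eq_append_iff.1 e4
  have := pos_inj k _ e3
  subst this
  exact ⟨L, B, R, e1, hh.1, hne, rfl, hd⟩

def SwRel (k m : ℕ) (u w : Word k) : Prop :=
  ∃ S c L B R, u = L ++ (B ++ c :: R) ∧ w = L ++ c :: (B ++ R) ∧ supp k u = S ∧ supp k w = S ∧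
    WD k m S c L B R

lemma WD.uniqL {k m : ℕ} {S : Finset (Idx k)} {c : Idx k} {L B R L' B' R' : Word k}
    (h : WD k m S c L B R) (h' : WD k m S c L' B' R')
    (e : L ++ c :: (B ++ R) = L' ++ c :: (B' ++ R')) : L = L' ∧ B = B' ∧ R = R' := by
  obtain ⟨-, -, -, -, -, -, h1, h2, h3⟩ := h
  obtain ⟨-, -, -, -, -, -, h1', h2', h3'⟩ := h'
  simp only [List.forall_mem_map] at *
  obtain ⟨rfl, e⟩ := split_unique (fun x => pos k S c < pos k S x) _ _ _ _ h1 h1'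
    (by simp) (by simp) e
  rename_i e'
  rw [List.cons.injEq] at e'
  obtain ⟨rfl, rfl⟩ := split_unique (fun x => pos k S x < pos k S c) _ _ _ _ h3 h3'
    (fun x hx => (h2 x (List.mem_of_mem_head? hx)).le.not_gt)
    (fun x hx => (h2' x (List.mem_of_mem_head? hx)).le.not_gt) e'.2
  exact ⟨rfl, rfl, rfl⟩

lemma WD.headB {k m : ℕ} {S : Finset (Idx k)} {c : Idx k} {L B R : Word k}
    (h : WD k m S c L B R) (X : Word k) :
    ∀ x ∈ (B ++ X).head?, ¬ pos k S c < pos k S x := by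
  obtain ⟨-, -, -, h0, -, -, h1, h2, h3⟩ := h
  have := h0.ne_nil
  intro x hx
  cases B with
  | nil => simp at this
  | cons b B =>
    simp at hx
    subst hx
    exact (h3 _ (by simp)).le.not_gt

lemma WD.uniqR {k m : ℕ} {S : Finset (Idx k)} {c : Idx k} {L B R L' B' R' : Word k}
    (h : WD k m S c L B R) (h' : WD k m S c L' B' R')
    (e : L ++ (B ++ c :: R) = L' ++ (B' ++ c :: R')) : L = L' ∧ B = B' ∧ R = R' := by
  have g := h.headB (c :: R)
  have g' := h'.headB (c :: R')
  obtain ⟨-, -, -, -, -, -, h1, h2, h3⟩ := h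
  obtain ⟨-, -, -, -, -, -, h1', h2', h3'⟩ := h'
  simp only [List.forall_mem_map] at *
  obtain ⟨rfl, e⟩ := split_unique (fun x => pos k S c < pos k S x) _ _ _ _ h1 h1' g g' e
  rename_i e'
  obtain ⟨f1, f2⟩ := split_unique (fun x => pos k S x < pos k S c) _ _ _ _ h3 h3'
    (by simp) (by simp) e'
  rw [List.cons.injEq] at f2
  exact ⟨rfl, f1, f2.2⟩

lemma SwRel.uniqR {k m : ℕ} {u w w' : Word k} (h : SwRel k m u w) (h' : SwRel k m u w') :
    w = w' := by
  obtain ⟨S, c, L, B, R, e, rfl, hs, -, h⟩ := h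
  obtain ⟨S', c', L', B', R', e', rfl, hs', -, h'⟩ := h'
  obtain rfl : S = S' := hs.symm.trans hs'
  obtain rfl : c = c' := h.hc.symm.trans h'.hc
  obtain ⟨rfl, rfl, rfl⟩ := h.uniqR h' (e.symm.trans e')
  rfl

lemma SwRel.uniqL {k m : ℕ} {u u' w : Word k} (h : SwRel k m u w) (h' : SwRel k m u' w) :
    u = u' := by
  obtain ⟨S, c, L, B, R, rfl, e, -, hs, h⟩ := h
  obtain ⟨S', c', L', B', R', rfl, e', -, hs', h'⟩ := h'
  obtain rfl : S = S' := hs.symm.trans hs'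
  obtain rfl : c = c' := h.hc.symm.trans h'.hc
  obtain ⟨rfl, rfl, rfl⟩ := h.uniqL h' (e.symm.trans e')
  rfl

lemma SwRel.aword {k m : ℕ} {u w : Word k} (h : SwRel k m u w) : Aword k u = Aword k w := by
  obtain ⟨S, c, L, B, R, rfl, rfl, hs, -, h⟩ := h
  apply Aword_swap
  intro b hb
  refine comm_of k S h.hS c b (h.hc ▸ uminS_mem k S h.ne) ?_
    (h.dec.cB _ (List.mem_map_of_mem hb))
  rw [← hs]
  exact List.mem_toFinset.2 (by simp [hb])

lemma SwRel.exR {k m r : ℕ} {i : ℤ} {u : Word k} (hu : u ∈ SR k m r i) :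
    ∃ w ∈ SL k m r (i - 1), SwRel k m u w := by
  obtain ⟨L, B, R, e, h⟩ := MN.exR hu
  have hs : supp k (L ++ umin k u :: (B ++ R)) = supp k u := by
    rw [← supp_swap, ← e]
  have ha := h.asc e rfl rfl hs
  have hi := hu.1.2.2
  have hr := hu.1.2.1
  refine ⟨_, h.memL rfl hs r (i - 1) ?_ (by omega), _, _, L, B, R, e, rfl, rfl, hs, h⟩
  rw [← (swap_perm L B R _).length_eq, ← e, hr]

lemma SwRel.exL {k m r : ℕ} {i : ℤ} {w : Word k} (hw : w ∈ SL k m r (i - 1)) :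
    ∃ u ∈ SR k m r i, SwRel k m u w := by
  obtain ⟨L, B, R, e, h⟩ := MN.exL hw
  have hs : supp k (L ++ (B ++ umin k w :: R)) = supp k w := by
    rw [supp_swap, ← e]
  have ha := h.asc rfl e hs rfl
  have hi := hw.1.2.2
  have hr := hw.1.2.1
  refine ⟨_, h.memR rfl hs r i ?_ (by omega), _, _, L, B, R, rfl, e, hs, rfl, h⟩
  rw [(swap_perm L B R _).length_eq, ← e, hr]

lemma main_bij (k m r : ℕ) (i : ℤ) :
    ∃ τ : SR k m r i → SL k m r (i - 1),
      Function.Bijective τ ∧ ∀ u : SR k m r i, Aword k (u : Word k) = Aword k (τ u : Word k) := by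
  choose f hf hr using fun u : SR k m r i => SwRel.exR u.2
  refine ⟨fun u => ⟨f u, hf u⟩, ⟨?_, ?_⟩, fun u => (hr u).aword⟩
  · intro u u' h
    have h : f u = f u' := congrArg Subtype.val h
    have h2 := hr u
    rw [h] at h2
    exact Subtype.ext (h2.uniqL (hr u'))
  · rintro ⟨w, hw⟩
    obtain ⟨u, hu, h⟩ := SwRel.exL hw
    exact ⟨⟨u, hu⟩, Subtype.ext ((hr ⟨u, hu⟩).uniqR h)⟩

theorem statement1 (k : ℕ) (hk : 1 ≤ k) (r : ℕ) (hr : 1 ≤ r) (i : ℤ) (hi : 1 ≤ i) :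
    (∃ τ : VSetNWCR k r i → VSetNWCL k r (i - 1),
      Function.Bijective τ ∧ ∀ u : VSetNWCR k r i, Aword k (u : Word k) = Aword k (τ u : Word k)) ∧
    (∃ τ : USetNWCR k r i → USetNWCL k r (i - 1),
      Function.Bijective τ ∧ ∀ u : USetNWCR k r i, Aword k (u : Word k) = Aword k (τ u : Word k)) := by
  have e1 : VSetNWCR k r i = SR k 0 r i := by
    ext u; simp [VSetNWCR, VSet, SR, hookV_iff]
  have e2 : VSetNWCL k r (i - 1) = SL k 0 r (i - 1) := by
    ext u; simp [VSetNWCL, VSet, SL, hookV_iff]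
  have e3 : USetNWCR k r i = SR k 1 r i := by
    ext u; simp [USetNWCR, USet, SR, hookU_iff]
  have e4 : USetNWCL k r (i - 1) = SL k 1 r (i - 1) := by
    ext u; simp [USetNWCL, USet, SL, hookU_iff]
  rw [e1, e2, e3, e4]
  exact ⟨main_bij k 0 r i, main_bij k 1 r i⟩

end MN

end
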